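/- arXiv:1807.08104 — 2 statements merged into one kernel-verified Lean document; each statement's English description precedes it below -/
import Mathlib

section
/- For m ≥ 3, γ_{×3,t}(K_3 □ K_m) equals 8 if m ∈ {3,4}, and equals 9 if m ≥ 5. -/
open SimpleGraph

/-- The `n × m` rook's graph, i.e. the Cartesian product `K_n □ K_m`. -/
def rook (n m : ℕ) : SimpleGraph (Fin n × Fin m) :=
  (⊤ : SimpleGraph (Fin n)) □ (⊤ : SimpleGraph (Fin m))

/-- `S` is a `k`-tuple total dominating set of `G`: every vertex has at least `k`
neighbours in `S`. -/
def IsTDS {V : Type*} (G : SimpleGraph V) (k : ℕ) (S : Set V) : Prop :=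
  ∀ v : V, k ≤ (S ∩ G.neighborSet v).ncard

/-- The `k`-tuple total domination number `γ_{×k,t}(K_n □ K_m)`. -/
noncomputable def gammaXt (k n m : ℕ) : ℕ :=
  sInf {c | ∃ S : Set (Fin n × Fin m), IsTDS (rook n m) k S ∧ S.ncard = c}


/-- The number of elements of `T` in row `i`. -/
def rowCard {n m : ℕ} (T : Finset (Fin n × Fin m)) (i : Fin n) : ℕ :=
  (Finset.univ.filter fun j => (i, j) ∈ T).card

/-- The number of elements of `T` in column `j`. -/
def colCard {n m : ℕ} (T : Finset (Fin n × Fin m)) (j : Fin m) : ℕ :=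
  (Finset.univ.filter fun i => (i, j) ∈ T).card

lemma rowCard_le {n m : ℕ} (T : Finset (Fin n × Fin m)) (i : Fin n) : rowCard T i ≤ m :=
  (Finset.card_le_univ _).trans_eq (Fintype.card_fin m)

lemma colCard_le {n m : ℕ} (T : Finset (Fin n × Fin m)) (j : Fin m) : colCard T j ≤ n :=
  (Finset.card_le_univ _).trans_eq (Fintype.card_fin n)

lemma sum_rowCard {n m : ℕ} (T : Finset (Fin n × Fin m)) : ∑ i, rowCard T i = T.card := by
  simp only [rowCard, Finset.card_filter]
  rw [← Fintype.sum_prod_type' (f := fun i j => if (i, j) ∈ T then 1 else 0)]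
  simp

lemma sum_colCard {n m : ℕ} (T : Finset (Fin n × Fin m)) : ∑ j, colCard T j = T.card := by
  simp only [colCard, Finset.card_filter]
  rw [← Fintype.sum_prod_type_right' (f := fun i j => if (i, j) ∈ T then 1 else 0)]
  simp

lemma ncard_inter_rook_neighborSet {n m : ℕ} (T : Finset (Fin n × Fin m)) (i : Fin n)
    (j : Fin m) :
    ((T : Set (Fin n × Fin m)) ∩ (rook n m).neighborSet (i, j)).ncard
      + (if (i, j) ∈ T then 2 else 0) = rowCard T i + colCard T j := by
  have hunion : (T : Set (Fin n × Fin m)) ∩ (rook n m).neighborSet (i, j) =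
      ↑((((Finset.univ.filter fun b => (i, b) ∈ T).erase j).map
          ⟨fun b => (i, b), Prod.mk_right_injective i⟩) ∪
        (((Finset.univ.filter fun a => (a, j) ∈ T).erase i).map
          ⟨fun a => (a, j), Prod.mk_left_injective j⟩)) := by
    ext ⟨a, b⟩
    simp only [rook, Set.mem_inter_iff, Finset.mem_coe, mem_neighborSet, boxProd_adj, top_adj,
      Finset.mem_union, Finset.mem_map, Finset.mem_erase, Finset.mem_filter, Finset.mem_univ,
      true_and, Function.Embedding.coeFn_mk, Prod.mk.injEq]
    grind
  rw [hunion, Set.ncard_coe_finset, Finset.card_union_of_disjoint, Finset.card_map,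
    Finset.card_map, rowCard, colCard]
  · by_cases h : (i, j) ∈ T
    · have hj : j ∈ Finset.univ.filter fun b => (i, b) ∈ T := by simpa using h
      have hi : i ∈ Finset.univ.filter fun a => (a, j) ∈ T := by simpa using h
      rw [← Finset.card_erase_add_one hj, ← Finset.card_erase_add_one hi, if_pos h]
      ring
    · rw [Finset.erase_eq_of_notMem (by simpa using h),
        Finset.erase_eq_of_notMem (by simpa using h), if_neg h, add_zero]
  · simp only [Finset.disjoint_left, Finset.mem_map, Finset.mem_erase,
      Function.Embedding.coeFn_mk]
    grind

lemma isTDS_rook_iff {n m k : ℕ} (T : Finset (Fin n × Fin m)) :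
    IsTDS (rook n m) k T ↔
      ∀ i j, k + (if (i, j) ∈ T then 2 else 0) ≤ rowCard T i + colCard T j := by
  simp only [← ncard_inter_rook_neighborSet, add_le_add_iff_right, IsTDS, Prod.forall]

lemma gammaXt_eq {k n m c : ℕ} (T : Finset (Fin n × Fin m)) (hT : IsTDS (rook n m) k T)
    (hc : T.card = c)
    (hmin : ∀ T : Finset (Fin n × Fin m), IsTDS (rook n m) k T → c ≤ T.card) :
    gammaXt k n m = c := by
  refine IsLeast.csInf_eq ⟨⟨T, hT, by rw [Set.ncard_coe_finset, hc]⟩, ?_⟩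
  rintro _ ⟨S, hS, rfl⟩
  lift S to Finset (Fin n × Fin m) using S.toFinite
  rw [Set.ncard_coe_finset]
  exact hmin S hS

lemma nine_le_card_of_three_le_rowCard {m : ℕ} (T : Finset (Fin 3 × Fin m))
    (h : ∀ i, 3 ≤ rowCard T i) : 9 ≤ T.card := by
  rw [← sum_rowCard]
  simpa using Finset.sum_le_sum fun i (_ : i ∈ Finset.univ) => h i

/-- A row meeting a 3-tuple total dominating set at most twice meets it exactly twice. -/
lemma rowCard_eq_two {m : ℕ} (hm : 0 < m) {T : Finset (Fin 3 × Fin m)}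
    (hT : IsTDS (rook 3 m) 3 T) {i : Fin 3} (hi : rowCard T i ≤ 2) : rowCard T i = 2 := by
  rw [isTDS_rook_iff] at hT
  have hmem : ∃ j, (i, j) ∈ T := by
    by_contra! hempty
    have hrow : rowCard T i = 0 := by simp [rowCard, hempty]
    have hcol := hT i ⟨0, hm⟩
    have hlt : colCard T ⟨0, hm⟩ < 3 := by
      refine (Finset.card_lt_univ_of_notMem (x := i) ?_).trans_eq (Fintype.card_fin 3)
      simpa using hempty _
    rw [hrow, if_neg (hempty _)] at hcol
    omega
  obtain ⟨j, hj⟩ := hmem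
  have hrc := hT i j
  rw [if_pos hj] at hrc
  have := colCard_le T j
  omega

lemma min_nine_le_card {m : ℕ} (hm : 0 < m) {T : Finset (Fin 3 × Fin m)}
    (hT : IsTDS (rook 3 m) 3 T) : min 9 (m + 4) ≤ T.card := by
  by_cases h : ∀ i, 3 ≤ rowCard T i
  · exact min_le_of_left_le (nine_le_card_of_three_le_rowCard T h)
  push Not at h
  obtain ⟨i, hi⟩ := h
  have hrow := rowCard_eq_two hm hT (Nat.le_of_lt_succ hi)
  rw [isTDS_rook_iff] at hT
  refine min_le_of_right_le ?_
  calc m + 4 = ∑ j, (1 + 2 * if (i, j) ∈ T then 1 else 0) := by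
        rw [Finset.sum_add_distrib, ← Finset.mul_sum, ← Finset.card_filter, ← rowCard, hrow]
        simp
    _ ≤ ∑ j, colCard T j := by
        refine Finset.sum_le_sum fun j _ => ?_
        have := hT i j
        split_ifs at this ⊢ <;> omega
    _ = T.card := sum_colCard T

lemma eight_le_card {T : Finset (Fin 3 × Fin 3)} (hT : IsTDS (rook 3 3) 3 T) :
    8 ≤ T.card := by
  by_cases h : ∀ i, 3 ≤ rowCard T i
  · exact (nine_le_card_of_three_le_rowCard T h).trans' (by norm_num)
  push Not at h
  obtain ⟨i, hi⟩ := h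
  have hrow := rowCard_eq_two (by norm_num) hT (Nat.le_of_lt_succ hi)
  rw [isTDS_rook_iff] at hT
  calc 8 = ∑ j, (2 + if (i, j) ∈ T then 1 else 0) := by
        rw [Finset.sum_add_distrib, ← Finset.card_filter, ← rowCard, hrow]
        simp
    _ ≤ ∑ j, colCard T j := by
        refine Finset.sum_le_sum fun j _ => ?_
        have hij := hT i j
        split_ifs at hij ⊢
        · omega
        have hpos : 0 < colCard T j := by omega
        obtain ⟨a, ha⟩ := Finset.card_pos.mp hpos
        have haj := hT a j
        rw [if_pos (Finset.mem_filter.mp ha).2] at haj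
        have := rowCard_le T a
        omega
    _ = T.card := sum_colCard T

lemma isTDS_univ_product {m : ℕ} {A : Finset (Fin m)} (hA : A.card = 3) :
    IsTDS (rook 3 m) 3 ↑((Finset.univ : Finset (Fin 3)) ×ˢ A) := by
  rw [isTDS_rook_iff]
  intro i j
  by_cases hj : j ∈ A <;> simp [rowCard, colCard, hA, hj]

theorem stmt_8 (m : ℕ) (hm : 3 ≤ m) :
    ((m = 3 ∨ m = 4) → gammaXt 3 3 m = 8) ∧ (5 ≤ m → gammaXt 3 3 m = 9) := by
  refine ⟨?_, fun h5 => ?_⟩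
  · rintro (rfl | rfl)
    · exact gammaXt_eq (Finset.univ.erase (0, 0)) ((isTDS_rook_iff _).mpr (by decide)) rfl
        fun _ hT => eight_le_card hT
    · exact gammaXt_eq (Finset.univ.filter fun v => v.1 = 0 ∨ v.2 = 0 ∨ v.2 = 1)
        ((isTDS_rook_iff _).mpr (by decide)) rfl
        fun _ hT => min_nine_le_card (by norm_num) hT
  · obtain ⟨A, -, hA⟩ := Finset.exists_subset_card_eq
      (s := (Finset.univ : Finset (Fin m))) (n := 3) (by simpa using hm)
    refine gammaXt_eq _ (isTDS_univ_product hA) (by simp [hA]) fun _ hT => ?_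
    have := min_nine_le_card (by omega) hT
    omega
end

section
/- For all n ≥ 3, γ_{×3,t}(K_n □ K_n) + 2 ≤ γ_{×3,t}(K_{n+1} □ K_{n+1}) ≤ γ_{×3,t}(K_n □ K_n) + 3. -/
open SimpleGraph

/-- The 0/1 matrix `A` is the indicator of a 3-tuple total dominating set of a rook's graph. -/
def IsDominating {α β : Type*} [Fintype α] [Fintype β] (A : α → β → ℕ) : Prop :=
  (∀ i j, A i j ≤ 1) ∧ ∀ i j, 3 + 2 * A i j ≤ (∑ j', A i j') + ∑ i', A i' j

lemma IsDominating.transpose {α β : Type*} [Fintype α] [Fintype β] {A : α → β → ℕ}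
    (h : IsDominating A) : IsDominating fun j i => A i j :=
  ⟨fun i j => h.1 j i, fun i j => by
    simpa only [add_comm] using h.2 j i⟩

open Classical in
/-- The indicator matrix of a set of cells. -/
noncomputable def cellMatrix {α β : Type*} (S : Set (α × β)) : α → β → ℕ :=
  fun i j => if (i, j) ∈ S then 1 else 0

lemma ncard_eq_sum_cellMatrix {α β : Type*} [Fintype α] [Fintype β] (S : Set (α × β)) :
    S.ncard = ∑ i, ∑ j, cellMatrix S i j := by
  classical
  rw [← Fintype.sum_prod_type', Set.ncard_eq_toFinset_card']
  simp [cellMatrix, Set.toFinset_card, Fintype.card_subtype]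

lemma ncard_inter_neighborSet_rook {n m : ℕ} (S : Set (Fin n × Fin m)) (i : Fin n) (j : Fin m) :
    (S ∩ (rook n m).neighborSet (i, j)).ncard + 2 * cellMatrix S i j =
      (∑ j', cellMatrix S i j') + ∑ i', cellMatrix S i' j := by
  have hpoint : ∀ a b, cellMatrix (S ∩ (rook n m).neighborSet (i, j)) a b +
      (if a = i then if b = j then 2 * cellMatrix S a b else 0 else 0) =
      (if a = i then cellMatrix S a b else 0) + if b = j then cellMatrix S a b else 0 := by
    intro a b
    by_cases hS : (a, b) ∈ S <;> by_cases ha : a = i <;> by_cases hb : b = j <;>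
      simp_all [cellMatrix, rook, SimpleGraph.boxProd_adj, eq_comm]
  have hsum := Finset.sum_congr rfl fun a (_ : a ∈ Finset.univ) =>
    Finset.sum_congr rfl fun b (_ : b ∈ Finset.univ) => hpoint a b
  simp only [Finset.sum_add_distrib, Finset.sum_ite_eq', Finset.mem_univ, if_true] at hsum
  rw [ncard_eq_sum_cellMatrix]
  have h1 : ∑ a, ∑ b, (if a = i then if b = j then 2 * cellMatrix S a b else 0 else 0) =
      2 * cellMatrix S i j := by
    rw [Finset.sum_eq_single i] <;> simp +contextual
  have h2 : ∑ a, ∑ b, (if a = i then cellMatrix S a b else 0) = ∑ b, cellMatrix S i b := by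
    rw [Finset.sum_eq_single i] <;> simp +contextual
  rwa [h1, h2] at hsum

lemma isTDS_rook_iff_s11 {n m : ℕ} (S : Set (Fin n × Fin m)) :
    IsTDS (rook n m) 3 S ↔ IsDominating (cellMatrix S) := by
  constructor
  · intro h
    refine ⟨fun i j => by unfold cellMatrix; split_ifs <;> simp, fun i j => ?_⟩
    have := h (i, j)
    have := ncard_inter_neighborSet_rook S i j
    omega
  · rintro ⟨-, h⟩ ⟨i, j⟩
    have := h i j
    have := ncard_inter_neighborSet_rook S i j
    omega

lemma IsDominating.two_le_row_or_col {α β : Type*} [Fintype α] [Fintype β] {A : α → β → ℕ}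
    (h : IsDominating A) : (∀ i, 2 ≤ ∑ j, A i j) ∨ ∀ j, 2 ≤ ∑ i, A i j := by
  by_contra! hc
  obtain ⟨⟨i, hi⟩, j, hj⟩ := hc
  have := h.2 i j
  omega

lemma eight_mul_add_three_mul_le {r c : ℕ} (hr : 2 ≤ r) (hc : 1 ≤ c) (h : 5 ≤ r + c) :
    8 * c + 3 * r ≤ 5 * (r * c) ∧ (8 * c + 3 * r = 5 * (r * c) → Even r) := by
  obtain rfl | rfl | hc : c = 1 ∨ c = 2 ∨ 3 ≤ c := by omega
  · exact ⟨by omega, fun h => ⟨2, by omega⟩⟩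
  · exact ⟨by omega, fun h => by omega⟩
  · obtain ⟨a, rfl⟩ := Nat.exists_eq_add_of_le hr
    obtain ⟨b, rfl⟩ := Nat.exists_eq_add_of_le hc
    refine ⟨by nlinarith, fun h => ?_⟩
    have : a = 0 := by nlinarith
    simp [this]

/-- The inequality is obtained by giving each one of `A`, in a row of sum `r` and a column of
sum `c`, the weight `8 / r + 3 / c ≤ 5`. -/
lemma IsDominating.eleven_mul_le_of_two_le_row {n : ℕ} (hn : 0 < n)
    {A : Fin n → Fin n → ℕ} (h : IsDominating A) (hrow : ∀ i, 2 ≤ ∑ j, A i j) :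
    11 * n ≤ 5 * ∑ i, ∑ j, A i j ∧
      (11 * n = 5 * ∑ i, ∑ j, A i j → Even (∑ i, ∑ j, A i j)) := by
  by_cases hcol : ∀ j, 1 ≤ ∑ i, A i j
  · set r : Fin n → ℕ := fun i => ∑ j, A i j with hr
    set c : Fin n → ℕ := fun j => ∑ i, A i j with hc
    have hr0 : ∀ i, (r i : ℚ) ≠ 0 := fun i => by have := hrow i; simp only [hr]; positivity
    have hc0 : ∀ j, (c j : ℚ) ≠ 0 := fun j => by have := hcol j; simp only [hc]; positivity
    have hterm : ∀ i j, 0 ≤ (A i j : ℚ) * (5 - 8 / r i - 3 / c j) ∧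
        ((A i j : ℚ) * (5 - 8 / r i - 3 / c j) = 0 → A i j ≠ 0 → Even (r i)) := by
      intro i j
      obtain h0 | h1 : A i j = 0 ∨ A i j = 1 := by have := h.1 i j; omega
      · simp [h0]
      · have hij : 5 ≤ r i + c j := by have := h.2 i j; rw [h1] at this; exact this
        obtain ⟨hle, heq⟩ := eight_mul_add_three_mul_le (hrow i) (hcol j) hij
        have hw : (5 - 8 / r i - 3 / c j : ℚ) =
            (5 * (r i * c j) - (8 * c j + 3 * r i)) / (r i * c j) := by
          have := hr0 i
          have := hc0 j
          field_simp
          ring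
        rw [hw, h1, Nat.cast_one, one_mul]
        refine ⟨div_nonneg (sub_nonneg.2 (by exact_mod_cast hle)) (by positivity), ?_⟩
        intro hz _
        rw [div_eq_zero_iff, or_iff_left (mul_ne_zero (hr0 i) (hc0 j)), sub_eq_zero] at hz
        exact heq (by exact_mod_cast hz.symm)
    have htotal : ∑ i, ∑ j, (A i j : ℚ) * (5 - 8 / r i - 3 / c j) =
        5 * (∑ i, ∑ j, A i j : ℕ) - 11 * n := by
      have h8 : ∑ i, ∑ j, (A i j : ℚ) * (8 / r i) = 8 * n := by
        have : ∀ i, ∑ j, (A i j : ℚ) * (8 / r i) = 8 := fun i => by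
          rw [← Finset.sum_mul, ← Nat.cast_sum]
          exact mul_div_cancel₀ _ (hr0 i)
        simp [this, mul_comm]
      have h3 : ∑ i, ∑ j, (A i j : ℚ) * (3 / c j) = 3 * n := by
        have : ∀ j, ∑ i, (A i j : ℚ) * (3 / c j) = 3 := fun j => by
          rw [← Finset.sum_mul, ← Nat.cast_sum]
          exact mul_div_cancel₀ _ (hc0 j)
        rw [Finset.sum_comm]
        simp [this, mul_comm]
      simp only [mul_sub, Finset.sum_sub_distrib, h8, h3]
      simp only [← Finset.sum_mul]
      push_cast
      ring
    have hnonneg : ∀ i ∈ Finset.univ, 0 ≤ ∑ j, (A i j : ℚ) * (5 - 8 / r i - 3 / c j) :=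
      fun i _ => Finset.sum_nonneg fun j _ => (hterm i j).1
    constructor
    · have := Finset.sum_nonneg hnonneg
      rw [htotal, sub_nonneg] at this
      exact_mod_cast this
    · intro heq
      have hzero : (5 * (∑ i, ∑ j, A i j : ℕ) - 11 * n : ℚ) = 0 :=
        sub_eq_zero.2 (by exact_mod_cast heq.symm)
      rw [← htotal, Finset.sum_eq_zero_iff_of_nonneg hnonneg] at hzero
      refine Finset.even_sum _ fun i _ => ?_
      obtain ⟨j, -, hj⟩ : ∃ j ∈ Finset.univ, A i j ≠ 0 := by
        by_contra! hc
        have := hrow i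
        rw [Finset.sum_eq_zero hc] at this
        omega
      have hi := (Finset.sum_eq_zero_iff_of_nonneg fun j _ => (hterm i j).1).1
        (hzero i (Finset.mem_univ i)) j (Finset.mem_univ j)
      exact (hterm i j).2 hi hj
  · push Not at hcol
    obtain ⟨j, hj⟩ := hcol
    have : ∑ _i : Fin n, 3 ≤ ∑ i, ∑ j, A i j :=
      Finset.sum_le_sum fun i _ => by have := h.2 i j; omega
    simp only [Finset.sum_const, Finset.card_univ, Fintype.card_fin, smul_eq_mul] at this
    omega

lemma IsDominating.eleven_mul_le {n : ℕ} (hn : 0 < n) {A : Fin n → Fin n → ℕ}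
    (h : IsDominating A) :
    11 * n ≤ 5 * ∑ i, ∑ j, A i j ∧
      (11 * n = 5 * ∑ i, ∑ j, A i j → Even (∑ i, ∑ j, A i j)) := by
  obtain hrow | hcol := h.two_le_row_or_col
  · exact h.eleven_mul_le_of_two_le_row hn hrow
  · rw [Finset.sum_comm]
    exact h.transpose.eleven_mul_le_of_two_le_row hn hcol

lemma IsDominating.ten_le_of_two_le_row {A : Fin 4 → Fin 4 → ℕ}
    (h : IsDominating A) (hrow : ∀ i, 2 ≤ ∑ j, A i j) : 10 ≤ ∑ i, ∑ j, A i j := by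
  by_contra! hlt
  have hcol : ∀ j, 3 ≤ ∑ i, A i j := by
    intro j
    have h0 := h.2 0 j
    have h1 := h.2 1 j
    have h2 := h.2 2 j
    have h3 := h.2 3 j
    have r0 := hrow 0
    have r1 := hrow 1
    have r2 := hrow 2
    have r3 := hrow 3
    have a0 := h.1 0 j
    have a1 := h.1 1 j
    have a2 := h.1 2 j
    have a3 := h.1 3 j
    rw [Fin.sum_univ_four] at hlt h0 h1 h2 h3 ⊢
    rw [Fin.sum_univ_four (fun i => A i j)] at h0 h1 h2 h3
    simp only [Fin.sum_univ_four] at *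
    omega
  have : ∑ _j : Fin 4, 3 ≤ ∑ j, ∑ i, A i j := Finset.sum_le_sum fun j _ => hcol j
  rw [Finset.sum_comm] at this
  simp at this
  omega

lemma IsDominating.ten_le {A : Fin 4 → Fin 4 → ℕ} (h : IsDominating A) :
    10 ≤ ∑ i, ∑ j, A i j := by
  obtain hrow | hcol := h.two_le_row_or_col
  · exact h.ten_le_of_two_le_row hrow
  · rw [Finset.sum_comm]
    exact h.transpose.ten_le_of_two_le_row hcol

/-- A 0/1 matrix with row sums at least two and column sums at least one, in which every one lies
in a row and a column with sums adding up to at least five. Such matrices are dominating, and they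
are closed under block diagonal sums. -/
def IsBlock {α β : Type*} [Fintype α] [Fintype β] (A : α → β → ℕ) : Prop :=
  (∀ i j, A i j ≤ 1) ∧ (∀ i, 2 ≤ ∑ j, A i j) ∧ (∀ j, 1 ≤ ∑ i, A i j) ∧
    ∀ i j, A i j = 1 → 5 ≤ (∑ j', A i j') + ∑ i', A i' j

instance {α β : Type*} [Fintype α] [Fintype β] (A : α → β → ℕ) : Decidable (IsBlock A) :=
  by unfold IsBlock; infer_instance

lemma IsBlock.isDominating {α β : Type*} [Fintype α] [Fintype β] {A : α → β → ℕ}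
    (h : IsBlock A) : IsDominating A := by
  refine ⟨h.1, fun i j => ?_⟩
  have := h.1 i j
  have := h.2.1 i
  have := h.2.2.1 j
  have := h.2.2.2 i j
  omega

/-- The block diagonal sum of `A` and `B`. -/
def diagSum {α β γ δ : Type*} (A : α → β → ℕ) (B : γ → δ → ℕ) : α ⊕ γ → β ⊕ δ → ℕ :=
  Sum.elim (fun i => Sum.elim (A i) 0) (fun i => Sum.elim 0 (B i))

lemma isBlock_diagSum {α β γ δ : Type*} [Fintype α] [Fintype β] [Fintype γ] [Fintype δ]
    {A : α → β → ℕ} {B : γ → δ → ℕ} (hA : IsBlock A) (hB : IsBlock B) :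
    IsBlock (diagSum A B) := by
  obtain ⟨hA1, hA2, hA3, hA4⟩ := hA
  obtain ⟨hB1, hB2, hB3, hB4⟩ := hB
  refine ⟨?_, ?_, ?_, ?_⟩ <;> simp_all [diagSum, Fintype.sum_sum_type]

/-- There is an `n × m` block with `t` ones. -/
def HasBlock (n m t : ℕ) : Prop :=
  ∃ A : Fin n → Fin m → ℕ, IsBlock A ∧ ∑ i, ∑ j, A i j = t

lemma HasBlock.add {n m t n' m' t' : ℕ} (h : HasBlock n m t) (h' : HasBlock n' m' t') :
    HasBlock (n + n') (m + m') (t + t') := by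
  obtain ⟨A, hA, rfl⟩ := h
  obtain ⟨B, hB, rfl⟩ := h'
  obtain ⟨h1, h2, h3, h4⟩ := isBlock_diagSum hA hB
  have hrow : ∀ i, ∑ j, diagSum A B (finSumFinEquiv.symm i) (finSumFinEquiv.symm j) =
      ∑ j, diagSum A B (finSumFinEquiv.symm i) j :=
    fun i => Equiv.sum_comp finSumFinEquiv.symm _
  have hcol : ∀ j, ∑ i, diagSum A B (finSumFinEquiv.symm i) (finSumFinEquiv.symm j) =
      ∑ i, diagSum A B i (finSumFinEquiv.symm j) :=
    fun j => Equiv.sum_comp finSumFinEquiv.symm fun i =>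
      diagSum A B i (finSumFinEquiv.symm j)
  refine ⟨fun i j => diagSum A B (finSumFinEquiv.symm i) (finSumFinEquiv.symm j),
    ⟨fun i j => h1 _ _, fun i => ?_, fun j => ?_, fun i j hij => ?_⟩, ?_⟩
  · rw [hrow]; exact h2 _
  · rw [hcol]; exact h3 _
  · rw [hrow, hcol]; exact h4 _ _ hij
  · simp only [hrow]
    rw [Equiv.sum_comp finSumFinEquiv.symm fun i => ∑ j, diagSum A B i j]
    simp [diagSum, Fintype.sum_sum_type]

lemma hasBlock_full {n m : ℕ} (hn : 1 ≤ n) (hm : 2 ≤ m) (h : 5 ≤ n + m) :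
    HasBlock n m (n * m) :=
  ⟨fun _ _ => 1, by simpa [IsBlock] using ⟨fun _ => hm, fun _ => hn, fun _ _ => by omega⟩, by simp⟩

lemma hasBlock_three_three : HasBlock 3 3 8 :=
  ⟨![![1, 1, 1], ![1, 1, 1], ![1, 1, 0]], by decide, by decide⟩

lemma hasBlock_four_four : HasBlock 4 4 10 :=
  ⟨![![1, 1, 0, 0], ![1, 1, 0, 0], ![1, 1, 0, 0], ![1, 1, 1, 1]], by decide, by decide⟩

lemma hasBlock_five_three : HasBlock 5 3 10 :=
  ⟨![![1, 1, 0], ![1, 1, 0], ![1, 0, 1], ![1, 0, 1], ![0, 1, 1]], by decide, by decide⟩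

lemma hasBlock_six_three : HasBlock 6 3 12 :=
  ⟨![![1, 1, 0], ![1, 1, 0], ![1, 0, 1], ![1, 0, 1], ![0, 1, 1], ![0, 1, 1]], by decide, by decide⟩

lemma hasBlock_square (n : ℕ) (hn : 4 ≤ n) :
    HasBlock n n ((11 * n + 4) / 5 + if n % 10 = 4 ∨ n % 10 = 5 then 1 else 0) := by
  have h32 : HasBlock 3 2 6 := hasBlock_full (by simp) (by simp) (by simp)
  have h42 : HasBlock 4 2 8 := hasBlock_full (by simp) (by simp) (by simp)
  have h14 : HasBlock 1 4 4 := hasBlock_full (by simp) (by simp) (by simp)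
  have h15 : HasBlock 1 5 5 := hasBlock_full (by simp) (by simp) (by simp)
  have h64 : HasBlock 6 4 12 := h32.add h32
  have h1010 : HasBlock 10 10 22 := (h64.add h32).add h14
  induction n using Nat.strong_induction_on with
  | _ n ih =>
    by_cases hlarge : 14 ≤ n
    · obtain ⟨m, rfl⟩ := Nat.exists_eq_add_of_le' (show 10 ≤ n by omega)
      have := (ih m (by omega) (by omega)).add h1010
      convert this using 1
      rw [Nat.add_mod_right]
      omega
    · interval_cases n
      · exact hasBlock_four_four
      · exact h32.add (hasBlock_full (n := 2) (m := 3) (by simp) (by simp) (by simp))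
      · exact (hasBlock_full (n := 5) (m := 2) (by simp) (by simp) (by simp)).add h14
      · exact hasBlock_six_three.add h14
      · exact (h32.add h42).add h14
      · exact (h32.add hasBlock_five_three).add h14
      · exact h1010
      · exact (h64.add h42).add h15
      · exact (h64.add hasBlock_five_three).add h15
      · exact (h64.add h64).add h15

lemma HasBlock.exists_isTDS {n m t : ℕ} (h : HasBlock n m t) :
    ∃ S : Set (Fin n × Fin m), IsTDS (rook n m) 3 S ∧ S.ncard = t := by
  obtain ⟨A, hA, rfl⟩ := h
  have hS : cellMatrix {p : Fin n × Fin m | A p.1 p.2 = 1} = A := by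
    ext i j
    have := hA.1 i j
    simp only [cellMatrix, Set.mem_ofPred_eq]
    split_ifs <;> omega
  refine ⟨{p | A p.1 p.2 = 1}, ?_, ?_⟩
  · rw [isTDS_rook_iff_s11, hS]
    exact hA.isDominating
  · rw [ncard_eq_sum_cellMatrix, hS]

lemma HasBlock.gammaXt_le {n m t : ℕ} (h : HasBlock n m t) : gammaXt 3 n m ≤ t :=
  Nat.sInf_le h.exists_isTDS

lemma HasBlock.exists_isDominating {n m t : ℕ} (h : HasBlock n m t) :
    ∃ A : Fin n → Fin m → ℕ, IsDominating A ∧ ∑ i, ∑ j, A i j = gammaXt 3 n m := by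
  obtain ⟨S, hS, hc⟩ := Nat.sInf_mem (s := {c | ∃ S : Set (Fin n × Fin m),
    IsTDS (rook n m) 3 S ∧ S.ncard = c}) ⟨t, h.exists_isTDS⟩
  exact ⟨cellMatrix S, (isTDS_rook_iff_s11 S).1 hS, by rw [← ncard_eq_sum_cellMatrix, hc]; rfl⟩

lemma HasBlock.eleven_mul_le_gammaXt {n t : ℕ} (hn : 0 < n) (h : HasBlock n n t) :
    11 * n ≤ 5 * gammaXt 3 n n ∧ (11 * n = 5 * gammaXt 3 n n → Even (gammaXt 3 n n)) := by
  obtain ⟨A, hA, hc⟩ := h.exists_isDominating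
  rw [← hc]
  exact hA.eleven_mul_le hn

theorem stmt_11 (n : ℕ) (hn : 3 ≤ n) :
    gammaXt 3 n n + 2 ≤ gammaXt 3 (n + 1) (n + 1) ∧
    gammaXt 3 (n + 1) (n + 1) ≤ gammaXt 3 n n + 3 := by
  obtain rfl | hn : n = 3 ∨ 4 ≤ n := by omega
  · have h3 := hasBlock_three_three.gammaXt_le
    have h4 := hasBlock_four_four.gammaXt_le
    have l3 := hasBlock_three_three.eleven_mul_le_gammaXt (by simp)
    obtain ⟨A, hA, hc⟩ := hasBlock_four_four.exists_isDominating
    have l4 := hA.ten_le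
    change gammaXt 3 3 3 + 2 ≤ gammaXt 3 4 4 ∧ gammaXt 3 4 4 ≤ gammaXt 3 3 3 + 3
    omega
  · have u := (hasBlock_square n hn).gammaXt_le
    have u' := (hasBlock_square (n + 1) (by omega)).gammaXt_le
    obtain ⟨l, e⟩ := (hasBlock_square n hn).eleven_mul_le_gammaXt (by omega)
    obtain ⟨l', e'⟩ := (hasBlock_square (n + 1) (by omega)).eleven_mul_le_gammaXt (by omega)
    rw [Nat.even_iff] at e e'
    split_ifs at u u' <;> omega
end
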